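/- Let P ⊆ 2^ℕ be a closed set that is almost thin, with X the unique element of P such that P ∩ [X↾n] is not thin for every n, and let Q be a Π⁰₁ set witnessing that P itself is not thin (P ∩ Q not relatively clopen in P). Let S be the set of strings σ extendible in P such that P ∩ Q ∩ [σ] is not relatively clopen in P ∩ [σ]. Then X is the unique infinite path through S. -/

import Mathlib

set_option linter.unusedVariables false
open scoped Classical

namespace MO

/-- Oracle evaluation `Φ_e^X(n)`: run code `e` on input `n` paired with a finite
approximation `X↾s` of the oracle, for the least stage `s` at which it halts. -/
def OracleEval (e : ℕ) (X : ℕ → ℕ) (n : ℕ) : Part ℕ :=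
  Nat.rfindOpt fun s =>
    Nat.Partrec.Code.evaln s (Denumerable.ofNat Nat.Partrec.Code e)
      (Nat.pair n (Encodable.encode (List.ofFn fun i : Fin s => X i)))

/-- `X ≤_T Y` via index `e`. -/
def TRedVia (e : ℕ) (X Y : ℕ → ℕ) : Prop := ∀ n, OracleEval e Y n = Part.some (X n)

/-- Turing reducibility `X ≤_T Y`. -/
def TRed (X Y : ℕ → ℕ) : Prop := ∃ e, TRedVia e X Y

/-- `X ≡_T Y` via the pair of indices `(i, j)`. -/
def TEquivVia (i j : ℕ) (X Y : ℕ → ℕ) : Prop := TRedVia i X Y ∧ TRedVia j Y X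

/-- `φ` is computable from the oracle `C`. -/
def ComputableIn (C : ℕ → ℕ) (φ : ℕ → ℕ) : Prop := ∃ e, TRedVia e φ C

/-- Effective join `C ⊕ X`. -/
def oplus (C X : ℕ → ℕ) : ℕ → ℕ := fun n => if n % 2 = 0 then C (n / 2) else X (n / 2)

variable {Q : Type*} [Preorder Q]

/-- `A ≤_m B` (`Q`-valued) via the (total) computable function with index `e`. -/
def MRedVia (e : ℕ) (A B : ℕ → Q) : Prop :=
  ∀ n, ∃ m, m ∈ (Denumerable.ofNat Nat.Partrec.Code e).eval n ∧ A n ≤ B m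

/-- `A ≡_m B` via the pair of indices `(i, j)`. -/
def MEquivVia (i j : ℕ) (A B : ℕ → Q) : Prop := MRedVia i A B ∧ MRedVia j B A

/-- `Q`-many-one reducibility relative to the oracle `C`:  `A ≤_m^C B`. -/
def QmRedIn (C : ℕ → ℕ) (A B : ℕ → Q) : Prop :=
  ∃ φ : ℕ → ℕ, ComputableIn C φ ∧ ∀ n, A n ≤ B (φ n)

/-- `f ≤▽_m g`: many-one reducibility on a cone. -/
def ConeLE (f g : (ℕ → ℕ) → ℕ → Q) : Prop :=
  ∃ C, ∀ X, TRed C X → QmRedIn C (f X) (g X)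

/-- `f` is uniformly `(≤_T, ≤_m)`-order preserving. -/
def UOP (f : (ℕ → ℕ) → ℕ → Q) : Prop :=
  ∃ u : ℕ → ℕ, Computable u ∧
    ∀ e X Y, TRedVia e X Y → MRedVia (u e) (f X) (f Y)

/-- `f` is uniformly `(≡_T, ≡_m)`-invariant. -/
def UI (f : (ℕ → ℕ) → ℕ → Q) : Prop :=
  ∃ u : ℕ × ℕ → ℕ × ℕ, Computable u ∧
    ∀ i j X Y, TEquivVia i j X Y →
      MEquivVia (u (i, j)).1 (u (i, j)).2 (f X) (f Y)

/-- `𝔄(f)(n⌢X) = f(X)(n)`. -/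
def Afr (f : (ℕ → ℕ) → ℕ → Q) : (ℕ → ℕ) → Q :=
  fun Z => f (fun k => Z (k + 1)) (Z 0)

/-- `Q`-Wadge reducibility between `Q`-valued functions on Baire space. -/
def WRed (A B : (ℕ → ℕ) → Q) : Prop :=
  ∃ θ : (ℕ → ℕ) → ℕ → ℕ, Continuous θ ∧ ∀ X, A X ≤ B (θ X)

/-- The first `n` values of `X ∈ 2^ℕ` as a binary string. -/
def restrB (X : ℕ → Bool) (n : ℕ) : List Bool := List.ofFn fun i : Fin n => X i

/-- The basic clopen cylinder `[σ] ⊆ 2^ℕ`. -/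
def cylB (σ : List Bool) : Set (ℕ → Bool) := {X | restrB X σ.length = σ}

/-- `Π⁰₁` subsets of Cantor space: sets of paths through a computable subtree of `2^{<ω}`. -/
def Pi01 (S : Set (ℕ → Bool)) : Prop :=
  ∃ f : List Bool → Bool, Computable f ∧ S = {X | ∀ n, f (restrB X n) = true}

/-- `S` is relatively clopen in `P` (in the subspace topology of `P`). -/
def RelClopen (P S : Set (ℕ → Bool)) : Prop :=
  IsClopen (Subtype.val ⁻¹' S : Set ↥P)

/-- `P ⊆ 2^ℕ` is thin: every `Π⁰₁` set meets it in a relatively clopen set. -/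
def ThinSet (P : Set (ℕ → Bool)) : Prop :=
  ∀ S, Pi01 S → RelClopen P S

/-- `P` is almost thin: only finitely many `X` have no thin cylinder neighborhood in `P`. -/
def AlmostThin (P : Set (ℕ → Bool)) : Prop :=
  {X : ℕ → Bool | ∀ n, ¬ ThinSet (P ∩ cylB (restrB X n))}.Finite

/-- A (prefix-closed) tree on `2^{<ω}`. -/
def IsBTree (T : Set (List Bool)) : Prop := ∀ σ τ : List Bool, σ <+: τ → τ ∈ T → σ ∈ T

/-- The set `[T]` of infinite paths through `T ⊆ 2^{<ω}`. -/
def pathsB (T : Set (List Bool)) : Set (ℕ → Bool) := {X | ∀ n, restrB X n ∈ T}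

/-- Characteristic function of a set of naturals (classical). -/
noncomputable def chi (A : Set ℕ) : ℕ → ℕ := fun n => if n ∈ A then 1 else 0

/-- Convert an element of Cantor space to an element of Baire space. -/
def b2r (X : ℕ → Bool) : ℕ → ℕ := fun n => Bool.rec 0 1 (X n)

/-- The Turing jump of the oracle `X`, as a set of naturals. -/
def jumpSet (X : ℕ → ℕ) : Set ℕ := {e | (OracleEval e X e).Dom}

/-- A set of naturals is Turing reducible to a real. -/
noncomputable def SetTRed (A : Set ℕ) (Y : ℕ → ℕ) : Prop :=
  ∃ e, ∀ n, OracleEval e Y n = Part.some (chi A n)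

/-- A real coding a tree `T ⊆ 2^{<ω}`. -/
noncomputable def btreeReal (T : Set (List Bool)) : ℕ → ℕ :=
  chi {k | ∃ σ ∈ T, Encodable.encode σ = k}

/-- The double jump `T''` of (a real coding) the tree `T`, as a set of naturals. -/
noncomputable def btreeJump2 (T : Set (List Bool)) : Set ℕ :=
  jumpSet (chi (jumpSet (btreeReal T)))

/-- The tree of strings `σ` extendible in `P` where `P ∩ Q ∩ [σ]` is not relatively
clopen in `P ∩ [σ]`. -/
def SSet (P Q : Set (ℕ → Bool)) : Set (List Bool) :=
  {σ | (P ∩ cylB σ).Nonempty ∧ ¬ RelClopen (P ∩ cylB σ) Q}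

/-- A set is relatively clopen in `P` iff membership in it is locally constant on `P`. -/
theorem relClopen_iff_eventually (P S : Set (ℕ → Bool)) :
    RelClopen P S ↔ ∀ y ∈ P, ∀ᶠ z in nhdsWithin y P, (z ∈ S ↔ y ∈ S) := by
  have mem_iff (T : Set (ℕ → Bool)) :
      IsOpen (Subtype.val ⁻¹' T : Set ↥P) ↔ ∀ y ∈ P, y ∈ T → T ∈ nhdsWithin y P := by
    simp only [isOpen_iff_mem_nhds, preimage_coe_mem_nhds_subtype, Subtype.forall,
      Set.mem_preimage]
  rw [RelClopen, IsClopen, ← isOpen_compl_iff, ← Set.preimage_compl, mem_iff, mem_iff]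
  constructor
  · rintro ⟨hc, ho⟩ y hy
    by_cases h : y ∈ S
    · filter_upwards [ho y hy h] with z hz
      exact iff_of_true hz h
    · filter_upwards [hc y hy h] with z hz
      exact iff_of_false hz h
  · intro hl
    refine ⟨fun y hy h => ?_, fun y hy h => ?_⟩
    · filter_upwards [hl y hy] with z hz
      exact fun hzS => h (hz.1 hzS)
    · filter_upwards [hl y hy] with z hz
      exact hz.2 h

theorem mem_cylB_restrB (X : ℕ → Bool) (n : ℕ) : X ∈ cylB (restrB X n) := by
  simp [cylB, restrB]

theorem isOpen_cylB (σ : List Bool) : IsOpen (cylB σ) := by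
  have hc : Continuous fun (X : ℕ → Bool) (i : Fin σ.length) => X i := by fun_prop
  exact (isOpen_discrete {v : Fin σ.length → Bool | List.ofFn v = σ}).preimage hc

/-- Being relatively clopen is a local property. -/
theorem relClopen_of_forall_exists_cylB {P S : Set (ℕ → Bool)}
    (h : ∀ Y ∈ P, ∃ n, RelClopen (P ∩ cylB (restrB Y n)) S) : RelClopen P S := by
  rw [relClopen_iff_eventually]
  intro Y hY
  obtain ⟨n, hn⟩ := h Y hY
  have hmem := mem_cylB_restrB Y n
  have hev := (relClopen_iff_eventually _ _).1 hn Y ⟨hY, hmem⟩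
  rwa [nhdsWithin_inter_of_mem' (nhdsWithin_le_nhds ((isOpen_cylB _).mem_nhds hmem))] at hev

/-- For an almost thin closed `P` with unique everywhere-non-thin point `X`, and `Q`
a `Π⁰₁` witness that `P` is not thin, `X` is the unique path through `S`. -/
theorem unique_path_through_S (P : Set (ℕ → Bool)) (hP : IsClosed P)
    (hat : AlmostThin P) (X : ℕ → Bool)
    (hX : ∀ n, ¬ ThinSet (P ∩ cylB (restrB X n)))
    (huniq : ∀ Y : ℕ → Bool, (∀ n, ¬ ThinSet (P ∩ cylB (restrB Y n))) → Y = X)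
    (Q : Set (ℕ → Bool)) (hQ : Pi01 Q) (hw : ¬ RelClopen P Q) :
    (∀ n, restrB X n ∈ SSet P Q) ∧ ∀ Y : ℕ → Bool, (∀ n, restrB Y n ∈ SSet P Q) → Y = X := by
  refine ⟨fun n => ⟨?_, fun hn => hw ?_⟩, fun Y hY => huniq Y fun n ht => (hY n).2 (ht Q hQ)⟩
  · by_contra hne
    refine hX n fun T _ => (relClopen_iff_eventually _ _).2 fun y hy => ?_
    exact absurd ⟨y, hy⟩ hne
  · refine relClopen_of_forall_exists_cylB fun Y _ => ?_
    by_cases hYX : Y = X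
    · exact ⟨n, hYX ▸ hn⟩
    · have hY := mt (huniq Y) hYX
      push Not at hY
      obtain ⟨m, hm⟩ := hY
      exact ⟨m, hm Q hQ⟩

end MO
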